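/- For every 0 < α < 1, the cone C₁ := {f ∈ C⁰((0,1]) : f ≥ 0, f is decreasing, and x ↦ x^{α+1} f(x) is increasing} is invariant under the transfer operator P_β for every 0 < β ≤ α; that is, if f ∈ C₁ then P_β f ∈ C₁. -/

import Mathlib

open MeasureTheory Set

/-- The Pomeau–Manneville type map `T_β` on `[0,1]` (identified with the circle `S¹`):
`T_β x = x + 3^β/2^(1+β) x^(1+β)` for `x ≤ 2/3` and `T_β x = 3x - 2` otherwise. -/
noncomputable def Tmap (β x : ℝ) : ℝ :=
  if x ≤ 2/3 then x + (3:ℝ)^β / 2^(1+β) * x^(1+β) else 3*x - 2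

/-- The derivative of `T_β` (left-branch formula at `x ≤ 2/3`). -/
noncomputable def Tderiv (β x : ℝ) : ℝ :=
  if x ≤ 2/3 then 1 + (3:ℝ)^β / 2^(1+β) * (1+β) * x^β else 3

/-- The second derivative of `T_β`. -/
noncomputable def Tderiv2 (β x : ℝ) : ℝ :=
  if x ≤ 2/3 then (3:ℝ)^β / 2^(1+β) * (1+β) * β * x^(β-1) else 0

/-- The inverse of the left branch of `T_β` (for `x ∈ [0,1]` this is the unique
`y ∈ [0,2/3]` with `T_β y = x`). -/
noncomputable def leftInv (β x : ℝ) : ℝ :=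
  sSup {y : ℝ | y ∈ Set.Icc (0:ℝ) (2/3) ∧ Tmap β y ≤ x}

/-- The Perron–Frobenius transfer operator of `T_β` with respect to Lebesgue measure:
`P_β f (x) = ∑_{y ∈ T_β⁻¹ x} f y / T_β' y`; the right branch preimage of `x` is `(x+2)/3`,
where the derivative is `3`. -/
noncomputable def Pop (β : ℝ) (f : ℝ → ℝ) (x : ℝ) : ℝ :=
  f (leftInv β x) / Tderiv β (leftInv β x) + f ((x+2)/3) / 3

/-- `P_{β_{k+n}} ∘ ⋯ ∘ P_{β_{k+1}}`. -/
noncomputable def PopCompFrom (β : ℕ → ℝ) (k : ℕ) : ℕ → (ℝ → ℝ) → ℝ → ℝ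
  | 0, f => f
  | n+1, f => Pop (β (k+n+1)) (PopCompFrom β k n f)

/-- `P_{β_n} ∘ ⋯ ∘ P_{β_1}`. -/
noncomputable def PopComp (β : ℕ → ℝ) (n : ℕ) : (ℝ → ℝ) → ℝ → ℝ :=
  PopCompFrom β 0 n

/-- `T_{β_{k+n}} ∘ ⋯ ∘ T_{β_{k+1}}`. -/
noncomputable def TcompFrom (β : ℕ → ℝ) (k : ℕ) : ℕ → ℝ → ℝ
  | 0, x => x
  | n+1, x => Tmap (β (k+n+1)) (TcompFrom β k n x)

/-- The derivative `(T_{β_{k+n}} ∘ ⋯ ∘ T_{β_{k+1}})'(z)`, computed as the product of the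
derivatives along the orbit of `z`. -/
noncomputable def DcompFrom (β : ℕ → ℝ) (k n : ℕ) (z : ℝ) : ℝ :=
  ∏ i ∈ Finset.range n, Tderiv (β (k+i+1)) (TcompFrom β k i z)

/-- The averaging operator `A_ε f (x) = (1/(2ε)) ∫_{B_ε(x)} f dm` on the circle,
realized via the 1-periodic extension of `f`. -/
noncomputable def Aop (ε : ℝ) (f : ℝ → ℝ) (x : ℝ) : ℝ :=
  (1/(2*ε)) * ∫ t in (x-ε)..(x+ε), f (Int.fract t)

/-- The indicator function of the ball `B_ε(z)` of radius `ε` around `z` in the circle `ℝ/ℤ`. -/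
noncomputable def ballInd (ε z : ℝ) : ℝ → ℝ :=
  Set.indicator {y : ℝ | ∃ k : ℤ, |y - z - (k:ℝ)| < ε} (fun _ => 1)

/-- The cone `C₁ = {f ∈ C⁰((0,1]) : f ≥ 0, f decreasing, x ↦ x^(α+1) f x increasing}`. -/
def memC1 (α : ℝ) (f : ℝ → ℝ) : Prop :=
  ContinuousOn f (Set.Ioc 0 1) ∧ (∀ x ∈ Set.Ioc (0:ℝ) 1, 0 ≤ f x) ∧
  AntitoneOn f (Set.Ioc 0 1) ∧ MonotoneOn (fun x : ℝ => x^(α+1) * f x) (Set.Ioc 0 1)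

/-- `m(f) = ∫₀¹ f dm` (Lebesgue). -/
noncomputable def mInt (f : ℝ → ℝ) : ℝ := ∫ x in Set.Ioc (0:ℝ) 1, f x

/-- The cone `C₂ = {f ∈ C₁ ∩ L¹(m) : f x ≤ a x^(-α) m(f)}`. -/
def memC2 (α a : ℝ) (f : ℝ → ℝ) : Prop :=
  memC1 α f ∧ IntegrableOn f (Set.Ioc 0 1) volume ∧
  ∀ x ∈ Set.Ioc (0:ℝ) 1, f x ≤ a * x^(-α) * mInt f

/-- The `L¹(m)` norm on `[0,1]`. -/
noncomputable def L1norm (f : ℝ → ℝ) : ℝ := ∫ x in Set.Ioc (0:ℝ) 1, |f x|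

/-- The `C¹` norm `‖f‖_∞ + ‖f'‖_∞` on the circle. -/
noncomputable def C1norm (f : ℝ → ℝ) : ℝ :=
  (⨆ x : Set.Icc (0:ℝ) 1, |f (x:ℝ)|) + ⨆ x : Set.Icc (0:ℝ) 1, |deriv f (x:ℝ)|

/-- The left branch of `T_β` maps `2/3` to `1`. -/
theorem Tmap_two_thirds (β : ℝ) : Tmap β (2/3) = 1 := by
  have h2 : (0:ℝ) < 2 ^ (1+β) := by positivity
  have h3 : (0:ℝ) < 3 ^ (1+β) := by positivity
  have h : (3:ℝ) ^ (1+β) = 3 * 3 ^ β := by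
    rw [Real.rpow_add (by norm_num), Real.rpow_one]
  rw [Tmap, if_pos le_rfl, Real.div_rpow (by norm_num) (by norm_num)]
  have : (3:ℝ) ^ β / 2 ^ (1+β) * (2 ^ (1+β) / 3 ^ (1+β)) = 1/3 := by
    rw [h] at h3 ⊢
    field_simp
  rw [this]
  norm_num

/-- The left branch of `T_β` expands distances. -/
theorem sub_le_Tmap_sub {β y z : ℝ} (hβ : 0 < β) (hy : 0 ≤ y) (hyz : y ≤ z) (hz : z ≤ 2/3) :
    z - y ≤ Tmap β z - Tmap β y := by
  rw [Tmap, Tmap, if_pos hz, if_pos (hyz.trans hz)]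
  have h1 : y ^ (1+β) ≤ z ^ (1+β) := Real.rpow_le_rpow hy hyz (by linarith)
  have h2 := mul_le_mul_of_nonneg_left h1 (by positivity : (0:ℝ) ≤ 3 ^ β / 2 ^ (1+β))
  linarith

theorem continuousOn_Tmap {β : ℝ} (hβ : 0 < β) : ContinuousOn (Tmap β) (Icc 0 (2/3)) := by
  have h : ContinuousOn (fun y : ℝ => y + (3:ℝ)^β / 2^(1+β) * y^(1+β)) (Icc 0 (2/3)) :=
    (continuous_id.add (continuous_const.mul
      (Real.continuous_rpow_const (by linarith)))).continuousOn
  exact h.congr fun y hy => by rw [Tmap, if_pos hy.2]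

theorem leftInv_spec {β x : ℝ} (hβ : 0 < β) (hx : x ∈ Ioc (0:ℝ) 1) :
    leftInv β x ∈ Ioc (0:ℝ) (2/3) ∧ Tmap β (leftInv β x) = x := by
  have h0 : Tmap β 0 = 0 := by
    rw [Tmap, if_pos (by norm_num), Real.zero_rpow (by linarith)]
    ring
  obtain ⟨y, hy, hyx⟩ : x ∈ Tmap β '' Icc 0 (2/3) := by
    apply intermediate_value_Icc (by norm_num) (continuousOn_Tmap hβ)
    rw [h0, Tmap_two_thirds]
    exact ⟨hx.1.le, hx.2⟩
  have hg : IsGreatest {y : ℝ | y ∈ Icc (0:ℝ) (2/3) ∧ Tmap β y ≤ x} y := by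
    refine ⟨⟨hy, hyx.le⟩, fun z hz => ?_⟩
    by_contra! hlt
    have := sub_le_Tmap_sub hβ hy.1 hlt.le hz.1.2
    linarith [hz.2]
  have he : leftInv β x = y := hg.csSup_eq
  rw [he]
  refine ⟨⟨lt_of_le_of_ne hy.1 ?_, hy.2⟩, hyx⟩
  rintro rfl
  linarith [hx.1]

theorem monotoneOn_leftInv {β : ℝ} (hβ : 0 < β) : MonotoneOn (leftInv β) (Ioc 0 1) := by
  intro x hx x' hx' hxx
  obtain ⟨h, e⟩ := leftInv_spec hβ hx
  obtain ⟨h', e'⟩ := leftInv_spec hβ hx'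
  by_contra! hlt
  have := sub_le_Tmap_sub hβ h'.1.le hlt.le h.2
  linarith

theorem continuousOn_leftInv {β : ℝ} (hβ : 0 < β) : ContinuousOn (leftInv β) (Ioc 0 1) := by
  refine (LipschitzOnWith.of_le_add (f := leftInv β) fun x hx x' hx' => ?_).continuousOn
  obtain ⟨h, e⟩ := leftInv_spec hβ hx
  obtain ⟨h', e'⟩ := leftInv_spec hβ hx'
  rw [Real.dist_eq]
  rcases le_total (leftInv β x) (leftInv β x') with hl | hl
  · linarith [abs_nonneg (x - x')]
  · have := sub_le_Tmap_sub hβ h'.1.le hl h.2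
    linarith [le_abs_self (x - x')]

theorem Tderiv_pos {β y : ℝ} (hβ : 0 < β) (hy : 0 ≤ y) : 0 < Tderiv β y := by
  rw [Tderiv]
  split_ifs <;> positivity

theorem monotoneOn_Tderiv {β : ℝ} (hβ : 0 < β) : MonotoneOn (Tderiv β) (Icc 0 (2/3)) := by
  intro y hy z hz hyz
  rw [Tderiv, Tderiv, if_pos hy.2, if_pos hz.2]
  have := Real.rpow_le_rpow hy.1 hyz hβ.le
  gcongr

theorem continuousOn_Tderiv {β : ℝ} (hβ : 0 < β) : ContinuousOn (Tderiv β) (Icc 0 (2/3)) := by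
  have h : ContinuousOn (fun y : ℝ => 1 + (3:ℝ)^β / 2^(1+β) * (1+β) * y^β) (Icc 0 (2/3)) :=
    (continuous_const.add (continuous_const.mul
      (Real.continuous_rpow_const hβ.le))).continuousOn
  exact h.congr fun y hy => by rw [Tderiv, if_pos hy.2]

/-- A Bernoulli-type inequality: `u ↦ (1 + u)^a / (1 + b u)` is increasing on `[0, ∞)` when
`1 ≤ b ≤ a`. -/
theorem one_add_rpow_div_le {a b u v : ℝ} (hb : 1 ≤ b) (hba : b ≤ a) (hu : 0 ≤ u) (huv : u ≤ v) :
    (1 + u) ^ a / (1 + b * u) ≤ (1 + v) ^ a / (1 + b * v) := by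
  have hv : 0 ≤ v := hu.trans huv
  have hs : 0 ≤ (v - u) / (1 + u) := div_nonneg (by linarith) (by linarith)
  have hsplit : (1 + v) ^ a = (1 + u) ^ a * (1 + (v - u) / (1 + u)) ^ a := by
    rw [← Real.mul_rpow (by linarith) (by linarith)]
    congr 1
    field_simp
    ring
  have hbern := one_add_mul_self_le_rpow_one_add (by linarith : -1 ≤ (v - u) / (1 + u))
    (hb.trans hba)
  have hlin : 1 + b * v ≤ (1 + a * ((v - u) / (1 + u))) * (1 + b * u) := by
    have h1 : b * ((v - u) / (1 + u)) ≤ a * ((v - u) / (1 + u)) :=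
      mul_le_mul_of_nonneg_right hba hs
    have h2 : (v - u) / (1 + u) * (1 + u) = v - u := div_mul_cancel₀ _ (by linarith)
    have h3 : 1 + u ≤ 1 + b * u := by nlinarith
    have h4 : (v - u) / (1 + u) * (1 + u) ≤ (v - u) / (1 + u) * (1 + b * u) :=
      mul_le_mul_of_nonneg_left h3 hs
    have h5 := mul_le_mul_of_nonneg_right h1 (by linarith : 0 ≤ 1 + b * u)
    nlinarith
  have hbu : 0 ≤ b * u := mul_nonneg (by linarith) hu
  have hbv : 0 ≤ b * v := mul_nonneg (by linarith) hv
  rw [div_le_div_iff₀ (by linarith) (by linarith), hsplit, mul_assoc]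
  exact mul_le_mul_of_nonneg_left
    (hlin.trans (mul_le_mul_of_nonneg_right hbern (by linarith))) (by positivity)

/-- The distortion factor `(T_β y / y)^(α+1) / T_β' y` is increasing on the left branch. -/
theorem monotoneOn_Tmap_div_rpow_div_Tderiv {α β : ℝ} (hβ : 0 < β) (hβα : β ≤ α) :
    MonotoneOn (fun y => (Tmap β y / y) ^ (α+1) / Tderiv β y) (Ioc 0 (2/3)) := by
  have key : ∀ y ∈ Ioc (0:ℝ) (2/3), (Tmap β y / y) ^ (α+1) / Tderiv β y =
      (1 + (3:ℝ)^β / 2^(1+β) * y ^ β) ^ (α+1) /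
        (1 + (1+β) * ((3:ℝ)^β / 2^(1+β) * y ^ β)) := by
    intro y hy
    have hy0 : y ≠ 0 := hy.1.ne'
    rw [Tmap, Tderiv, if_pos hy.2, if_pos hy.2, Real.rpow_add hy.1 1 β, Real.rpow_one]
    congr 2
    · field_simp
    · ring
  intro y hy z hz hyz
  simp only [key y hy, key z hz]
  have := Real.rpow_le_rpow hy.1.le hyz hβ.le
  have hy0 := hy.1
  exact one_add_rpow_div_le (by linarith) (by linarith) (by positivity) (by gcongr)

/-- For every `0 < α < 1`, the cone `C₁` is invariant under the transfer
operator `P_β` for every `0 < β ≤ α`. -/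
theorem cone_C1_invariant (α β : ℝ) (hα0 : 0 < α) (hα1 : α < 1)
    (hβ0 : 0 < β) (hβα : β ≤ α) (f : ℝ → ℝ) (hf : memC1 α f) :
    memC1 α (Pop β f) := by
  obtain ⟨hc, hn, ha, hm⟩ := hf
  have hL : ∀ x ∈ Ioc (0:ℝ) 1, leftInv β x ∈ Ioc (0:ℝ) (2/3) :=
    fun x hx => (leftInv_spec hβ0 hx).1
  have hL1 : ∀ x ∈ Ioc (0:ℝ) 1, leftInv β x ∈ Ioc (0:ℝ) 1 :=
    fun x hx => ⟨(hL x hx).1, (hL x hx).2.trans (by norm_num)⟩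
  have hL2 : ∀ x ∈ Ioc (0:ℝ) 1, leftInv β x ∈ Icc (0:ℝ) (2/3) :=
    fun x hx => Ioc_subset_Icc_self (hL x hx)
  have hR : ∀ x ∈ Ioc (0:ℝ) 1, (x+2)/3 ∈ Ioc (0:ℝ) 1 :=
    fun x hx => ⟨by linarith [hx.1], by linarith [hx.2]⟩
  have hD : ∀ x ∈ Ioc (0:ℝ) 1, 0 < Tderiv β (leftInv β x) :=
    fun x hx => Tderiv_pos hβ0 (hL x hx).1.le
  refine ⟨?_, ?_, ?_, ?_⟩
  · have hLc := continuousOn_leftInv hβ0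
    have hRc : ContinuousOn (fun x : ℝ => (x+2)/3) (Ioc 0 1) := by fun_prop
    exact ((hc.comp hLc hL1).div ((continuousOn_Tderiv hβ0).comp hLc hL2)
      fun x hx => (hD x hx).ne').add ((hc.comp hRc hR).div_const 3)
  · intro x hx
    exact add_nonneg (div_nonneg (hn _ (hL1 x hx)) (hD x hx).le)
      (div_nonneg (hn _ (hR x hx)) (by norm_num))
  · intro x hx x' hx' hxx
    have hl := monotoneOn_leftInv hβ0 hx hx' hxx
    have h1 := ha (hL1 x hx) (hL1 x' hx') hl
    have h2 := ha (hR x hx) (hR x' hx') (by linarith)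
    exact add_le_add
      (div_le_div₀ (hn _ (hL1 x hx)) h1 (hD x hx)
        (monotoneOn_Tderiv hβ0 (hL2 x hx) (hL2 x' hx') hl))
      (div_le_div_of_nonneg_right h2 (by norm_num))
  · have split : ∀ x ∈ Ioc (0:ℝ) 1, x^(α+1) * Pop β f x =
        (leftInv β x ^ (α+1) * f (leftInv β x)) *
          ((Tmap β (leftInv β x) / leftInv β x) ^ (α+1) / Tderiv β (leftInv β x)) +
        (((x+2)/3) ^ (α+1) * f ((x+2)/3)) * ((x / ((x+2)/3)) ^ (α+1) / 3) := by
      intro x hx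
      have hy := (hL x hx).1
      have hz := (hR x hx).1
      have hd := (hD x hx).ne'
      rw [(leftInv_spec hβ0 hx).2, Real.div_rpow hx.1.le hy.le, Real.div_rpow hx.1.le hz.le, Pop]
      have hy' := (Real.rpow_pos_of_pos hy (α+1)).ne'
      have hz' := (Real.rpow_pos_of_pos hz (α+1)).ne'
      generalize leftInv β x ^ (α+1) = p at *
      generalize ((x+2)/3) ^ (α+1) = q at *
      field_simp
    intro x hx x' hx' hxx
    simp only [split x hx, split x' hx']
    have hl := monotoneOn_leftInv hβ0 hx hx' hxx
    have hx0 := hx.1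
    have hx0' := hx'.1
    refine add_le_add (mul_le_mul (hm (hL1 x hx) (hL1 x' hx') hl)
      (monotoneOn_Tmap_div_rpow_div_Tderiv hβ0 hβα (hL x hx) (hL x' hx') hl) ?_ ?_)
      (mul_le_mul (hm (hR x hx) (hR x' hx') (by linarith)) ?_ (by positivity) ?_)
    · rw [(leftInv_spec hβ0 hx).2]
      exact div_nonneg (Real.rpow_nonneg (div_nonneg hx.1.le (hL x hx).1.le) _) (hD x hx).le
    · exact mul_nonneg (Real.rpow_nonneg (hL x' hx').1.le _) (hn _ (hL1 x' hx'))
    · refine div_le_div_of_nonneg_right (Real.rpow_le_rpow (by positivity) ?_ (by linarith))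
        (by norm_num)
      rw [div_le_div_iff₀ (by positivity) (by positivity)]
      nlinarith
    · exact mul_nonneg (Real.rpow_nonneg (hR x' hx').1.le _) (hn _ (hR x' hx'))
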